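/- Let E be a centrally orthocomplete pseudo-effect algebra, (pᵢ)_{i∈I} a Γ-orthogonal family in E, p := ⋁_{i∈I} pᵢ, cᵢ := γpᵢ for each i ∈ I, and c := ⋁_{i∈I} cᵢ. Then: (i) p ≤ γp = c and c is central; (ii) p ∧ cᵢ = pᵢ for all i ∈ I; (iii) if e ∈ E with e ≤ p, then e ∧ cᵢ = e ∧ pᵢ for all i ∈ I and e = ⋁_{i∈I}(e ∧ pᵢ). -/

import Mathlib

namespace PEApaper

/-- The bare data of a partial-addition structure: a partial binary operation
(encoded via `Option`) together with constants `0` and `1`. -/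
structure PartialStruct (E : Type) where
  padd : E → E → Option E
  zero : E
  one : E

namespace PartialStruct

variable {E : Type}

/-- `a ≤ b` iff `a + c = b` for some `c`. -/
def le (P : PartialStruct E) (a b : E) : Prop := ∃ c, P.padd a c = some b

/-- `m` is the greatest lower bound (meet `a ∧ b`) of `a` and `b`. -/
def IsMeet (P : PartialStruct E) (a b m : E) : Prop :=
  P.le m a ∧ P.le m b ∧ ∀ x, P.le x a → P.le x b → P.le x m

/-- `j` is the least upper bound (join `a ∨ b`) of `a` and `b`. -/
def IsJoin (P : PartialStruct E) (a b j : E) : Prop :=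
  P.le a j ∧ P.le b j ∧ ∀ x, P.le a x → P.le b x → P.le j x

/-- `s` is the supremum of the set `S`. -/
def IsSup (P : PartialStruct E) (S : Set E) (s : E) : Prop :=
  (∀ x ∈ S, P.le x s) ∧ ∀ u, (∀ x ∈ S, P.le x u) → P.le s u

/-- Left-associated partial sum of a list, continuing from `acc`. -/
def IsSumFrom (P : PartialStruct E) : E → List E → E → Prop
  | acc, [], s => s = acc
  | acc, a :: l, s => ∃ t, P.padd acc a = some t ∧ IsSumFrom P t l s

/-- `s` is the (left-associated) orthosum `e₁ + e₂ + ⋯ + eₙ` of the list. -/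
def IsSumList (P : PartialStruct E) (l : List E) (s : E) : Prop :=
  match l with
  | [] => s = P.zero
  | a :: t => IsSumFrom P a t s

/-- `c` is a central element: there is a PEA-isomorphism
`f : E → E[0,c] × E[0,c∼]` with `f c = (c,0)` such that `f x = (x₁,x₂)`
implies `x = x₁ + x₂`.  The isomorphism onto the product of the two
interval pseudo-effect algebras is spelled out explicitly. -/
def IsCentral (P : PartialStruct E) (c : E) : Prop :=
  ∃ cs, P.padd c cs = some P.one ∧
    ∃ f : E → E × E,
      (∀ x, P.le (f x).1 c ∧ P.le (f x).2 cs) ∧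
      Function.Injective f ∧
      (∀ y : E × E, P.le y.1 c → P.le y.2 cs → ∃ x, f x = y) ∧
      f c = (c, P.zero) ∧
      f P.one = (c, cs) ∧
      (∀ x, P.padd (f x).1 (f x).2 = some x) ∧
      (∀ a b ab, P.padd a b = some ab →
        P.padd (f a).1 (f b).1 = some (f ab).1 ∧
        P.padd (f a).2 (f b).2 = some (f ab).2) ∧
      (∀ a b s t, P.padd (f a).1 (f b).1 = some s → P.le s c →
        P.padd (f a).2 (f b).2 = some t → P.le t cs →
        ∃ ab, P.padd a b = some ab)

/-- The center `Γ(E)`. -/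
def center (P : PartialStruct E) : Set E := {c | P.IsCentral c}

/-- The central interval `Γ(E)[0,c] = Γ(E) ∩ E[0,c]`. -/
def centerIntervalSet (P : PartialStruct E) (c : E) : Set E :=
  {x | P.IsCentral x ∧ P.le x c}

/-- A Γ-orthogonal family: one dominated elementwise by a pairwise
disjoint family of central elements. -/
def GammaOrthogonal (P : PartialStruct E) {I : Type} (e : I → E) : Prop :=
  ∃ c : I → E, (∀ i, P.IsCentral (c i)) ∧
    (∀ i j, i ≠ j → P.IsMeet (c i) (c j) P.zero) ∧
    ∀ i, P.le (e i) (c i)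

/-- Centrally orthocomplete: every Γ-orthogonal family has a supremum. -/
def IsCOPEA (P : PartialStruct E) : Prop :=
  ∀ (I : Type) (e : I → E), P.GammaOrthogonal e → ∃ s, P.IsSup (Set.range e) s

/-- `c` is the central cover of `e`: the smallest central element above `e`. -/
def IsCentralCover (P : PartialStruct E) (c e : E) : Prop :=
  P.IsCentral c ∧ P.le e c ∧ ∀ d, P.IsCentral d → P.le e d → P.le c d

/-- `[Q]`: the set of all suprema of Γ-orthogonal families of elements of `Q`. -/
def bra (P : PartialStruct E) (Q : Set E) : Set E :=
  {s | ∃ (I : Type) (e : I → E), (∀ i, e i ∈ Q) ∧ P.GammaOrthogonal e ∧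
    P.IsSup (Set.range e) s}

/-- `Q^γ = {q ∧ c : q ∈ Q, c ∈ Γ(E)}`. -/
def gammaClosure (P : PartialStruct E) (Q : Set E) : Set E :=
  {m | ∃ q ∈ Q, ∃ c, P.IsCentral c ∧ P.IsMeet q c m}

/-- `Q↓ = ⋃_{q ∈ Q} E[0,q]`. -/
def downSet (P : PartialStruct E) (Q : Set E) : Set E :=
  {e | ∃ q ∈ Q, P.le e q}

/-- `Q' = {e ∈ E : q ∧ e = 0 for all q ∈ Q}`. -/
def commutant (P : PartialStruct E) (Q : Set E) : Set E :=
  {e | ∀ q ∈ Q, P.IsMeet q e P.zero}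

/-- A type-determining (TD) set: `K = [K] = K^γ`. -/
def IsTD (P : PartialStruct E) (K : Set E) : Prop :=
  P.bra K = K ∧ P.gammaClosure K = K

/-- A strongly type-determining (STD) set: `K = [K] = K↓`. -/
def IsSTD (P : PartialStruct E) (K : Set E) : Prop :=
  P.bra K = K ∧ P.downSet K = K

/-- `c` is the type-cover of `K` (w.r.t. the central cover map `γ`):
the unique central element with `γK = Γ(E)[0,c]`. -/
def IsTypeCover (P : PartialStruct E) (γ : E → E) (K : Set E) (c : E) : Prop :=
  P.IsCentral c ∧ γ '' K = P.centerIntervalSet c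

/-- An atom: a nonzero element with no proper nonzero subelement. -/
def IsAtom' (P : PartialStruct E) (a : E) : Prop :=
  a ≠ P.zero ∧ ∀ x, P.le x a → x = P.zero ∨ x = a

end PartialStruct

/-- A PEA-isomorphism between two partial-addition structures: a bijective
morphism whose inverse is a morphism. -/
structure IsPEAIso {A B : Type} (P : PartialStruct A) (Q : PartialStruct B)
    (f : A → B) : Prop where
  bijective : Function.Bijective f
  map_one : f P.one = Q.one
  map_add : ∀ a b ab, P.padd a b = some ab → Q.padd (f a) (f b) = some (f ab)
  rev_add : ∀ a b s, Q.padd (f a) (f b) = some s → ∃ ab, P.padd a b = some ab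

open scoped Classical in
/-- The (coordinatewise) product of a family of partial structures. -/
noncomputable def prodStruct {I : Type} {A : I → Type}
    (Ps : ∀ i, PartialStruct (A i)) : PartialStruct (∀ i, A i) where
  padd a b :=
    if h : ∀ i, ∃ s, (Ps i).padd (a i) (b i) = some s
    then some fun i => Classical.choose (h i)
    else none
  zero := fun i => (Ps i).zero
  one := fun i => (Ps i).one

/-- A pseudo-effect algebra. -/
structure PEA (E : Type) extends PartialStruct E where
  assoc_def : ∀ a b c : E,
    (∃ ab, padd a b = some ab ∧ ∃ x, padd ab c = some x) ↔
    (∃ bc, padd b c = some bc ∧ ∃ y, padd a bc = some y)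
  assoc_eq : ∀ a b c ab bc x y, padd a b = some ab → padd ab c = some x →
    padd b c = some bc → padd a bc = some y → x = y
  exu_right : ∀ a : E, ∃! d, padd a d = some one
  exu_left : ∀ a : E, ∃! e, padd e a = some one
  shift : ∀ a b ab, padd a b = some ab →
    (∃ d, padd d a = some ab) ∧ (∃ e, padd b e = some ab)
  one_add : ∀ a x, padd one a = some x → a = zero
  add_one : ∀ a x, padd a one = some x → a = zero

namespace PEA

variable {E : Type} (P : PEA E)

/-- Shorthand for the underlying partial structure. -/
abbrev ps : PartialStruct E := P.toPartialStruct

theorem one_add_zero : P.padd P.one P.zero = some P.one := by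
  obtain ⟨d, hd, -⟩ := P.exu_right P.one
  have h := P.one_add d P.one hd
  rwa [h] at hd

theorem zero_add_one : P.padd P.zero P.one = some P.one := by
  obtain ⟨e, he, -⟩ := P.exu_left P.one
  have h := P.add_one e P.one he
  rwa [h] at he

theorem padd_zero (a : E) : P.padd a P.zero = some a := by
  obtain ⟨e, he, -⟩ := P.exu_left a
  have h1 : ∃ ab, P.padd e a = some ab ∧ ∃ x, P.padd ab P.zero = some x :=
    ⟨P.one, he, P.one, P.one_add_zero⟩
  obtain ⟨t, ht, y, hy⟩ := (P.assoc_def e a P.zero).mp h1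
  have hxy : P.one = y :=
    P.assoc_eq e a P.zero P.one t P.one y he P.one_add_zero ht hy
  obtain ⟨d, hd, hu⟩ := P.exu_right e
  have hta : t = a := by
    have h2 : t = d := hu t (by rw [← hxy] at hy; exact hy)
    have h3 : a = d := hu a he
    rw [h2, h3]
  rwa [hta] at ht

theorem zero_padd (a : E) : P.padd P.zero a = some a := by
  obtain ⟨d, hd, -⟩ := P.exu_right a
  have h1 : ∃ bc, P.padd a d = some bc ∧ ∃ y, P.padd P.zero bc = some y :=
    ⟨P.one, hd, P.one, P.zero_add_one⟩
  obtain ⟨t, ht, y, hy⟩ := (P.assoc_def P.zero a d).mpr h1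
  have hxy : y = P.one :=
    P.assoc_eq P.zero a d t P.one y P.one ht hy hd P.zero_add_one
  obtain ⟨e, he, hu⟩ := P.exu_left d
  have hta : t = a := by
    have h2 : t = e := hu t (by rw [hxy] at hy; exact hy)
    have h3 : a = e := hu a hd
    rw [h2, h3]
  rwa [hta] at ht

theorem zero_le (a : E) : P.ps.le P.zero a := ⟨a, P.zero_padd a⟩

theorem le_refl (a : E) : P.ps.le a a := ⟨P.zero, P.padd_zero a⟩

open scoped Classical in
/-- The interval pseudo-effect algebra `E[0,p]` as a partial structure on
the subtype `{x // x ≤ p}`; the sum is defined iff it is defined in `E`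
and lies below `p`, and the unit is `p`. -/
noncomputable def intervalStruct (p : E) :
    PartialStruct {x : E // P.ps.le x p} where
  padd a b := (P.padd a.1 b.1).bind fun s =>
    if h : P.ps.le s p then some ⟨s, h⟩ else none
  zero := ⟨P.zero, P.zero_le p⟩
  one := ⟨p, P.le_refl p⟩

end PEA

/-- The order relation of a complete Boolean algebra structure, made explicit. -/
def cbaLe {X : Type} (inst : CompleteBooleanAlgebra X) (a b : X) : Prop :=
  @LE.le X (by letI := inst; exact inferInstance) a b

end PEApaper

namespace PEApaper

namespace PEA

variable {E : Type} (P : PEA E)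

theorem assoc_right {a b c ab x : E} (h₁ : P.padd a b = some ab) (h₂ : P.padd ab c = some x) :
    ∃ bc, P.padd b c = some bc ∧ P.padd a bc = some x := by
  obtain ⟨bc, hbc, y, hy⟩ := (P.assoc_def a b c).mp ⟨ab, h₁, x, h₂⟩
  obtain rfl := P.assoc_eq a b c ab bc x y h₁ h₂ hbc hy
  exact ⟨bc, hbc, hy⟩

theorem assoc_left {a b c bc x : E} (h₁ : P.padd b c = some bc) (h₂ : P.padd a bc = some x) :
    ∃ ab, P.padd a b = some ab ∧ P.padd ab c = some x := by
  obtain ⟨ab, hab, y, hy⟩ := (P.assoc_def a b c).mpr ⟨bc, h₁, x, h₂⟩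
  obtain rfl := P.assoc_eq a b c ab bc y x hab hy h₁ h₂
  exact ⟨ab, hab, hy⟩

theorem add_left_cancel {a b c x : E} (h₁ : P.padd a b = some x) (h₂ : P.padd a c = some x) :
    b = c := by
  obtain ⟨y, hy, -⟩ := P.exu_left x
  obtain ⟨u, hu, hub⟩ := P.assoc_left h₁ hy
  obtain ⟨v, hv, hvc⟩ := P.assoc_left h₂ hy
  obtain rfl : u = v := Option.some.inj (hu.symm.trans hv)
  exact (P.exu_right u).unique hub hvc

theorem add_right_cancel {a b c x : E} (h₁ : P.padd b a = some x) (h₂ : P.padd c a = some x) :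
    b = c := by
  obtain ⟨y, hy, -⟩ := P.exu_right x
  obtain ⟨u, hu, hub⟩ := P.assoc_right h₁ hy
  obtain ⟨v, hv, hvc⟩ := P.assoc_right h₂ hy
  obtain rfl : u = v := Option.some.inj (hu.symm.trans hv)
  exact (P.exu_left u).unique hub hvc

theorem eq_zero_of_add_eq_zero {a b : E} (h : P.padd a b = some P.zero) :
    a = P.zero ∧ b = P.zero := by
  obtain ⟨u, hu, -⟩ := P.assoc_right h P.zero_add_one
  obtain rfl := P.add_one b u hu
  exact ⟨Option.some.inj ((P.padd_zero a).symm.trans h), rfl⟩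

theorem eq_zero_of_le_zero {a : E} (h : P.ps.le a P.zero) : a = P.zero :=
  let ⟨_, hb⟩ := h
  (P.eq_zero_of_add_eq_zero hb).1

theorem le_trans {a b c : E} (h₁ : P.ps.le a b) (h₂ : P.ps.le b c) : P.ps.le a c := by
  obtain ⟨u, hu⟩ := h₁
  obtain ⟨v, hv⟩ := h₂
  obtain ⟨w, -, hw⟩ := P.assoc_right hu hv
  exact ⟨w, hw⟩

theorem le_antisymm {a b : E} (h₁ : P.ps.le a b) (h₂ : P.ps.le b a) : a = b := by
  obtain ⟨u, hu⟩ := h₁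
  obtain ⟨v, hv⟩ := h₂
  obtain ⟨w, hw, hw'⟩ := P.assoc_right hu hv
  obtain rfl := P.add_left_cancel hw' (P.padd_zero a)
  obtain rfl := (P.eq_zero_of_add_eq_zero hw).1
  exact Option.some.inj ((P.padd_zero a).symm.trans hu)

theorem le_of_add_right {a b x : E} (h : P.padd a b = some x) : P.ps.le b x :=
  (P.shift a b x h).2

/-- `f` and `g` are the coordinate maps of a direct decomposition of `E` as
`E[0,c] × E[0,d]`. -/
structure IsDecomposition (c d : E) (f g : E → E) : Prop where
  fst_le : ∀ x, P.ps.le (f x) c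
  snd_le : ∀ x, P.ps.le (g x) d
  add_eq : ∀ x, P.padd (f x) (g x) = some x
  fst_add : ∀ {a b ab}, P.padd a b = some ab → P.padd (f a) (f b) = some (f ab)
  snd_add : ∀ {a b ab}, P.padd a b = some ab → P.padd (g a) (g b) = some (g ab)
  fst_of_le : ∀ {x}, P.ps.le x c → f x = x
  fst_of_le_snd : ∀ {x}, P.ps.le x d → f x = P.zero
  exists_add : ∀ {a b}, P.ps.le a c → P.ps.le b d → ∃ s, P.padd a b = some s

theorem exists_isDecomposition {c : E} (hc : P.ps.IsCentral c) :
    ∃ d f g, P.ps.IsCentral d ∧ P.IsDecomposition c d f g := by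
  obtain ⟨d, hcd, f, hle, hinj, hsurj, hfc, hf1, hsum, hadd, hrev⟩ := hc
  have hfd : f d = (P.zero, d) := by
    have h := hadd c d P.one hcd
    rw [hfc, hf1] at h
    exact Prod.ext (P.add_left_cancel h.1 (P.padd_zero c))
      (Option.some.inj ((P.zero_padd _).symm.trans h.2))
  have hf_le : ∀ {x}, P.ps.le x c → f x = (x, P.zero) := by
    rintro x ⟨y, hy⟩
    have h := (hadd x y c hy).2
    rw [hfc] at h
    have h0 := (P.eq_zero_of_add_eq_zero h).1
    have hx := hsum x
    rw [h0] at hx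
    exact Prod.ext (Option.some.inj ((P.padd_zero _).symm.trans hx)) h0
  have hf_le' : ∀ {x}, P.ps.le x d → f x = (P.zero, x) := by
    rintro x ⟨y, hy⟩
    have h := (hadd x y d hy).1
    rw [hfd] at h
    have h0 := (P.eq_zero_of_add_eq_zero h).1
    have hx := hsum x
    rw [h0] at hx
    exact Prod.ext h0 (Option.some.inj ((P.zero_padd _).symm.trans hx))
  have hswap : ∀ x, P.padd (f x).2 (f x).1 = some x := by
    intro x
    have h1 := hf_le (hle x).1
    have h2 := hf_le' (hle x).2
    obtain ⟨y, hy⟩ := hrev (f x).2 (f x).1 (f x).1 (f x).2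
      (by rw [h1, h2]; exact P.zero_padd _) (hle x).1
      (by rw [h1, h2]; exact P.padd_zero _) (hle x).2
    have h := hadd _ _ _ hy
    rw [h1, h2] at h
    have hxy : f x = f y := Prod.ext
      (Option.some.inj ((P.zero_padd _).symm.trans h.1))
      (Option.some.inj ((P.padd_zero _).symm.trans h.2))
    rw [← hinj hxy] at hy
    exact hy
  have hdc : P.padd d c = some P.one := by
    have h := hswap P.one
    rwa [hf1] at h
  refine ⟨d, fun x => (f x).1, fun x => (f x).2, ?_, ?_⟩
  · refine ⟨c, hdc, fun x => (f x).swap, fun x => (hle x).symm, fun x y h => hinj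
      (Prod.swap_injective h), ?_, by simp [hfd], by simp [hf1], hswap,
      fun a b ab h => (hadd a b ab h).symm, fun a b s t hs hsd ht htc => hrev a b t s ht htc hs hsd⟩
    intro y h1 h2
    obtain ⟨x, hx⟩ := hsurj y.swap h2 h1
    exact ⟨x, by simp [hx]⟩
  · refine ⟨fun x => (hle x).1, fun x => (hle x).2, hsum, fun h => (hadd _ _ _ h).1,
      fun h => (hadd _ _ _ h).2, fun h => by simp [hf_le h], fun h => by simp [hf_le' h], ?_⟩
    intro a b ha hb
    obtain ⟨x, hx⟩ := hsurj (a, b) ha hb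
    have h := hsum x
    rw [hx] at h
    exact ⟨x, h⟩

namespace IsDecomposition

variable {P} {c d : E} {f g : E → E} (h : P.IsDecomposition c d f g)
include h

theorem fst_le_self (x : E) : P.ps.le (f x) x := ⟨_, h.add_eq x⟩

theorem fst_mono {x y : E} (hxy : P.ps.le x y) : P.ps.le (f x) (f y) :=
  let ⟨_, hz⟩ := hxy
  ⟨_, h.fst_add hz⟩

theorem snd_mono {x y : E} (hxy : P.ps.le x y) : P.ps.le (g x) (g y) :=
  let ⟨_, hz⟩ := hxy
  ⟨_, h.snd_add hz⟩

theorem isMeet (x : E) : P.ps.IsMeet x c (f x) := by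
  refine ⟨h.fst_le_self x, h.fst_le x, fun y hyx hyc => ?_⟩
  have := h.fst_mono hyx
  rwa [h.fst_of_le hyc] at this

theorem snd_of_fst_eq_zero {x : E} (hx : f x = P.zero) : g x = x := by
  have := h.add_eq x
  rw [hx] at this
  exact Option.some.inj ((P.zero_padd _).symm.trans this)

theorem le_of_fst_eq_zero {x : E} (hx : f x = P.zero) : P.ps.le x d := by
  have := h.snd_le x
  rwa [h.snd_of_fst_eq_zero hx] at this

/-- Elements below a central element disjoint from `c` have zero first coordinate. -/
theorem fst_eq_zero_of_disjoint {x c' : E} (hx : P.ps.le x c') (hd : P.ps.IsMeet c c' P.zero) :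
    f x = P.zero :=
  P.eq_zero_of_le_zero (hd.2.2 _ (h.fst_le x) (P.le_trans (h.fst_le_self x) hx))

/-- A supremum of elements, all but one of which lie in the second factor, has that one as
its first coordinate. -/
theorem fst_isSup {I : Type} {p : I → E} {s : E} (hs : P.ps.IsSup (Set.range p) s) {i : I}
    (hi : P.ps.le (p i) c) (hj : ∀ j, j ≠ i → f (p j) = P.zero) : f s = p i := by
  obtain ⟨u, hu⟩ := h.exists_add hi (h.snd_le s)
  have hsu : P.ps.le s u := by
    refine hs.2 u ?_
    rintro _ ⟨j, rfl⟩
    by_cases hji : j = i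
    · subst hji
      exact ⟨_, hu⟩
    · have := h.snd_mono (hs.1 (p j) ⟨j, rfl⟩)
      rw [h.snd_of_fst_eq_zero (hj j hji)] at this
      exact P.le_trans this (P.le_of_add_right hu)
  have hfu : f u = p i := by
    have := h.fst_add hu
    rw [h.fst_of_le hi, h.fst_of_le_snd (h.snd_le s)] at this
    exact Option.some.inj (this.symm.trans (P.padd_zero _))
  refine P.le_antisymm ?_ ?_
  · have := h.fst_mono hsu
    rwa [hfu] at this
  · have := h.fst_mono (hs.1 (p i) ⟨i, rfl⟩)
    rwa [h.fst_of_le hi] at this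

end IsDecomposition

theorem isCentral_of_isSup_disjoint {I : Type} (hγ : ∀ e, ∃ c, P.ps.IsCentralCover c e)
    {c : I → E} (hc : ∀ i, P.ps.IsCentral (c i))
    (hdisj : ∀ i j, i ≠ j → P.ps.IsMeet (c i) (c j) P.zero)
    {s : E} (hs : P.ps.IsSup (Set.range c) s) : P.ps.IsCentral s := by
  obtain ⟨d, hd, hsd, hdmin⟩ := hγ s
  obtain ⟨r, hr⟩ := id hsd
  obtain ⟨k, hk, hrk, hkmin⟩ := hγ r
  obtain ⟨k', f, g, hk', H⟩ := P.exists_isDecomposition hk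
  have hck : ∀ i, P.ps.le (c i) k' := by
    intro i
    obtain ⟨c', f', g', hc', H'⟩ := P.exists_isDecomposition (hc i)
    have h1 : f' s = c i := H'.fst_isSup hs (P.le_refl _) fun j hj =>
      H'.fst_eq_zero_of_disjoint (P.le_refl _) (hdisj i j hj.symm)
    have h2 : f' d = c i := by
      refine P.le_antisymm (H'.fst_le d) ?_
      have := H'.fst_mono hsd
      rwa [h1] at this
    have h3 := H'.fst_add hr
    rw [h1, h2] at h3
    have hrc : P.ps.le r c' :=
      H'.le_of_fst_eq_zero (P.add_left_cancel h3 (P.padd_zero _))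
    have hkc := hkmin c' hc' hrc
    refine H.le_of_fst_eq_zero ?_
    rw [← H'.fst_of_le (H.fst_le_self (c i)),
      H'.fst_of_le_snd (P.le_trans (H.fst_le _) hkc)]
  have hdk : P.ps.le d k' := hdmin k' hk' (hs.2 k' (by rintro _ ⟨i, rfl⟩; exact hck i))
  have hr0 : r = P.zero := by
    rw [← H.fst_of_le hrk, H.fst_of_le_snd (P.le_trans (P.le_of_add_right hr) hdk)]
  rw [hr0] at hr
  obtain rfl : s = d := Option.some.inj ((P.padd_zero s).symm.trans hr)
  exact hd

end PEA

end PEApaper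

open PEApaper PEApaper.PartialStruct in
/-- Lemma 4.11: in a COPEA, for a Γ-orthogonal family `(pᵢ)` with
`p := ⋁ᵢ pᵢ`, `cᵢ := γpᵢ`, `c := ⋁ᵢ cᵢ`:
(i) `p ≤ γp = c` (and `c` is central);
(ii) `p ∧ cᵢ = pᵢ` for all `i`;
(iii) if `e ≤ p` then `e ∧ cᵢ = e ∧ pᵢ` for all `i` and `e = ⋁ᵢ (e ∧ pᵢ)`. -/
theorem stmt10 {E I : Type} (P : PEA E) (hco : P.ps.IsCOPEA)
    (γ : E → E) (hγ : ∀ e, P.ps.IsCentralCover (γ e) e)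
    (p : I → E) (hp : P.ps.GammaOrthogonal p)
    (psup : E) (hpsup : P.ps.IsSup (Set.range p) psup)
    (csup : E) (hcsup : P.ps.IsSup (Set.range fun i => γ (p i)) csup) :
    (P.ps.le psup csup ∧ γ psup = csup ∧ P.ps.IsCentral csup) ∧
    (∀ i, P.ps.IsMeet psup (γ (p i)) (p i)) ∧
    (∀ e, P.ps.le e psup →
      ∃ m : I → E, (∀ i, P.ps.IsMeet e (γ (p i)) (m i) ∧
        P.ps.IsMeet e (p i) (m i)) ∧ P.ps.IsSup (Set.range m) e) := by
  obtain ⟨d, hd, hdisj, hpd⟩ := hp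
  have hcd : ∀ i, P.ps.le (γ (p i)) (d i) := fun i => (hγ (p i)).2.2 _ (hd i) (hpd i)
  have hcdisj : ∀ i j, i ≠ j → P.ps.IsMeet (γ (p i)) (γ (p j)) P.zero := fun i j hij =>
    ⟨P.zero_le _, P.zero_le _, fun x hi hj =>
      (hdisj i j hij).2.2 x (P.le_trans hi (hcd i)) (P.le_trans hj (hcd j))⟩
  choose c' f g _ H using fun i => P.exists_isDecomposition (hγ (p i)).1
  have hproj : ∀ (q : I → E) (s : E), (∀ i, P.ps.le (q i) (γ (p i))) →
      P.ps.IsSup (Set.range q) s → ∀ i, f i s = q i := fun q s hq hs i =>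
    (H i).fst_isSup hs (hq i) fun j hj =>
      (H i).fst_eq_zero_of_disjoint (hq j) (hcdisj i j hj.symm)
  have hpf := hproj p psup (fun i => (hγ (p i)).2.1) hpsup
  have hcent : P.ps.IsCentral csup :=
    P.isCentral_of_isSup_disjoint (fun e => ⟨γ e, hγ e⟩) (fun i => (hγ (p i)).1) hcdisj hcsup
  have hle : P.ps.le psup csup := hpsup.2 _ (by
    rintro _ ⟨i, rfl⟩
    exact P.le_trans (hγ (p i)).2.1 (hcsup.1 _ ⟨i, rfl⟩))
  refine ⟨⟨hle, P.le_antisymm ((hγ psup).2.2 _ hcent hle) (hcsup.2 _ ?_), hcent⟩, ?_, ?_⟩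
  · rintro _ ⟨i, rfl⟩
    exact (hγ (p i)).2.2 _ (hγ psup).1 (P.le_trans (hpsup.1 _ ⟨i, rfl⟩) (hγ psup).2.1)
  · intro i
    have := (H i).isMeet psup
    rwa [hpf i] at this
  · intro e he
    have hfp : ∀ i, P.ps.le (f i e) (p i) := fun i => by
      have := (H i).fst_mono he
      rwa [hpf i] at this
    refine ⟨fun i => f i e, fun i => ⟨(H i).isMeet e, (H i).fst_le_self e, hfp i,
      fun x hxe hxp => ((H i).isMeet e).2.2 x hxe (P.le_trans hxp (hγ (p i)).2.1)⟩, ?_⟩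
    obtain ⟨s, hs⟩ := hco I (fun i => f i e)
      ⟨fun i => γ (p i), fun i => (hγ (p i)).1, hcdisj, fun i => (H i).fst_le e⟩
    have hse : P.ps.le s e := hs.2 e (by rintro _ ⟨i, rfl⟩; exact (H i).fst_le_self e)
    have hsf := hproj _ s (fun i => (H i).fst_le e) hs
    obtain ⟨r, hr⟩ := hse
    obtain ⟨t, ht⟩ := he
    obtain ⟨rt, hrt, hsrt⟩ := P.assoc_right hr ht
    obtain ⟨t', ht'⟩ := (P.shift _ _ _ hrt).1
    obtain ⟨x, -, hx⟩ := P.assoc_left ht' hsrt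
    have hfr : ∀ i, f i r = P.zero := fun i => by
      have := (H i).fst_add hr
      rw [hsf i] at this
      exact P.add_left_cancel this (P.padd_zero _)
    have hpx : P.ps.le psup x := hpsup.2 x (by
      rintro _ ⟨i, rfl⟩
      have := (H i).fst_add hx
      rw [hfr i, hpf i, P.padd_zero] at this
      rw [← Option.some.inj this]
      exact (H i).fst_le_self x)
    obtain rfl : x = psup := P.le_antisymm ⟨r, hx⟩ hpx
    obtain rfl := P.add_left_cancel hx (P.padd_zero x)
    obtain rfl : s = e := Option.some.inj ((P.padd_zero s).symm.trans hr)
    exact hs
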